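/- For every n ≥ 2 and every t₀ > 0, the function t ↦ p(n,t) has a derivative at t₀ satisfying 2 t₀ (d/dt) p(n,t)|_{t=t₀} = (1 − (−1)^n) t₀ − β_n(t₀) R_n(t₀). -/

import Mathlib

open MeasureTheory Polynomial

/-- The singularly perturbed Gaussian weight `w(x,t) = exp(-x^2 - t/x^2)` for `x ≠ 0`,
extended by `0` at `x = 0`. -/
noncomputable def w (t x : ℝ) : ℝ := if x = 0 then 0 else Real.exp (-x ^ 2 - t / x ^ 2)

theorem coeff_comp_neg_X (Q : ℝ[X]) (k : ℕ) :
    (Q.comp (-X)).coeff k = (-1) ^ k * Q.coeff k := by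
  rw [show (-X : ℝ[X]) = C (-1) * X by simp, comp_C_mul_X_coeff, mul_comm]

section OrthogonalPolynomials

variable {L : ℝ[X] →ₗ[ℝ] ℝ} {P : ℕ → ℝ[X]}

/-- Pairing with the `m`-th monic orthogonal polynomial extracts the coefficient of degree `m`. -/
theorem apply_mul_monic_orthogonal (hmonic : ∀ n, (P n).Monic) (hdeg : ∀ n, (P n).natDegree = n)
    (horth : ∀ m n, m ≠ n → L (P m * P n) = 0) {m : ℕ} {Q : ℝ[X]} (hQ : Q.natDegree ≤ m) :
    L (Q * P m) = Q.coeff m * L (P m * P m) := by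
  have lower : ∀ d : ℕ, d ≤ m → ∀ Q : ℝ[X], Q.degree < d → L (Q * P m) = 0 := by
    intro d
    induction d with
    | zero =>
      intro _ Q hQ
      have : Q = 0 := by
        rw [← degree_eq_bot]
        exact Nat.WithBot.lt_zero_iff.mp (by simpa using hQ)
      simp [this]
    | succ d ih =>
      intro hd Q hQ
      have hc : (P d).coeff d = 1 := by
        have := hmonic d
        rwa [Monic, leadingCoeff, hdeg] at this
      have hlt : (Q - C (Q.coeff d) * P d).degree < d := by
        rw [degree_lt_iff_coeff_zero]
        intro k hk
        rcases hk.eq_or_lt with rfl | hk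
        · simp [hc]
        · have h1 : Q.coeff k = 0 := coeff_eq_zero_of_degree_lt
            (hQ.trans_le (by exact_mod_cast hk))
          have h2 : (P d).coeff k = 0 := coeff_eq_zero_of_natDegree_lt (by rwa [hdeg])
          simp [h1, h2]
      have h0 := ih (by omega) _ hlt
      have : Q * P m = (Q - C (Q.coeff d) * P d) * P m + Q.coeff d • (P d * P m) := by
        rw [smul_eq_C_mul]; ring
      rw [this, map_add, map_smul, h0, horth d m (by omega)]
      simp
  have hc : (P m).coeff m = 1 := by
    have := hmonic m
    rwa [Monic, leadingCoeff, hdeg] at this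
  have hlt : (Q - C (Q.coeff m) * P m).degree < m := by
    rw [degree_lt_iff_coeff_zero]
    intro k hk
    rcases hk.eq_or_lt with rfl | hk
    · simp [hc]
    · have h1 : Q.coeff k = 0 := coeff_eq_zero_of_natDegree_lt (by omega)
      have h2 : (P m).coeff k = 0 := coeff_eq_zero_of_natDegree_lt (by rwa [hdeg])
      simp [h1, h2]
  have h0 := lower m le_rfl _ hlt
  have : Q * P m = (Q - C (Q.coeff m) * P m) * P m + Q.coeff m • (P m * P m) := by
    rw [smul_eq_C_mul]; ring
  rw [this, map_add, map_smul, h0]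
  simp

theorem apply_mul_eq_zero_of_natDegree_lt (hmonic : ∀ n, (P n).Monic)
    (hdeg : ∀ n, (P n).natDegree = n) (horth : ∀ m n, m ≠ n → L (P m * P n) = 0)
    {m : ℕ} {Q : ℝ[X]} (hQ : Q.natDegree < m) : L (Q * P m) = 0 := by
  rw [apply_mul_monic_orthogonal hmonic hdeg horth hQ.le, coeff_eq_zero_of_natDegree_lt hQ,
    zero_mul]

theorem eq_zero_of_forall_apply_mul_eq_zero (hmonic : ∀ n, (P n).Monic)
    (hdeg : ∀ n, (P n).natDegree = n) (horth : ∀ m n, m ≠ n → L (P m * P n) = 0)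
    (hpos : ∀ n, 0 < L (P n * P n)) {n : ℕ} {D : ℝ[X]} (hD : D.degree < n)
    (h : ∀ k < n, L (D * P k) = 0) : D = 0 := by
  by_contra hne
  have hlt : D.natDegree < n := (natDegree_lt_iff_degree_lt hne).2 hD
  have h0 := h _ hlt
  rw [apply_mul_monic_orthogonal hmonic hdeg horth le_rfl] at h0
  rcases mul_eq_zero.1 h0 with h0 | h0
  · exact hne (leadingCoeff_eq_zero.1 h0)
  · exact (hpos _).ne' h0

/-- Monic orthogonal polynomials for an even functional have definite parity. -/
theorem comp_neg_X_monic_orthogonal (hmonic : ∀ n, (P n).Monic)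
    (hdeg : ∀ n, (P n).natDegree = n) (horth : ∀ m n, m ≠ n → L (P m * P n) = 0)
    (hpos : ∀ n, 0 < L (P n * P n)) (heven : ∀ Q, L (Q.comp (-X)) = L Q) (n : ℕ) :
    (P n).comp (-X) = C ((-1) ^ n) * P n := by
  have hc : (P n).coeff n = 1 := by
    have := hmonic n
    rwa [Monic, leadingCoeff, hdeg] at this
  rw [← sub_eq_zero]
  refine eq_zero_of_forall_apply_mul_eq_zero hmonic hdeg horth hpos (n := n) ?_ ?_
  · rw [degree_lt_iff_coeff_zero]
    intro k hk
    rw [coeff_sub, coeff_C_mul, coeff_comp_neg_X]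
    rcases hk.eq_or_lt with rfl | hk
    · simp
    · have h2 : (P n).coeff k = 0 := coeff_eq_zero_of_natDegree_lt (by rwa [hdeg])
      simp [h2]
  · intro k hk
    have e : ((P n).comp (-X) - C ((-1) ^ n) * P n) * P k =
        (((P k).comp (-X)) * P n).comp (-X) - ((-1 : ℝ) ^ n) • (P k * P n) := by
      rw [smul_eq_C_mul, mul_comp, comp_assoc]
      simp
      ring
    rw [e, map_sub, map_smul, heven, horth k n hk.ne,
      apply_mul_eq_zero_of_natDegree_lt hmonic hdeg horth]
    · simp
    · rw [natDegree_comp, hdeg]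
      simpa using hk

theorem coeff_eq_zero_of_odd_add (hmonic : ∀ n, (P n).Monic)
    (hdeg : ∀ n, (P n).natDegree = n) (horth : ∀ m n, m ≠ n → L (P m * P n) = 0)
    (hpos : ∀ n, 0 < L (P n * P n)) (heven : ∀ Q, L (Q.comp (-X)) = L Q) {n k : ℕ}
    (hnk : Odd (n + k)) : (P n).coeff k = 0 := by
  have h := congrArg (fun Q => coeff Q k)
    (comp_neg_X_monic_orthogonal hmonic hdeg horth hpos heven n)
  simp only [coeff_comp_neg_X, coeff_C_mul] at h
  rcases Nat.even_or_odd n with hn | hn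
  · have hk : Odd k := by grind
    rw [hn.neg_one_pow, hk.neg_one_pow] at h
    linarith
  · have hk : Even k := by grind
    rw [hn.neg_one_pow, hk.neg_one_pow] at h
    linarith

/-- The three-term recurrence for an even functional. -/
theorem X_mul_monic_orthogonal (hmonic : ∀ n, (P n).Monic)
    (hdeg : ∀ n, (P n).natDegree = n) (horth : ∀ m n, m ≠ n → L (P m * P n) = 0)
    (hpos : ∀ n, 0 < L (P n * P n)) (heven : ∀ Q, L (Q.comp (-X)) = L Q) (n : ℕ) :
    X * P (n + 1) =
      P (n + 2) + C (L (P (n + 1) * P (n + 1)) / L (P n * P n)) * P n := by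
  have hc : ∀ n, (P n).coeff n = 1 := fun n => by
    have := hmonic n
    rwa [Monic, leadingCoeff, hdeg] at this
  set b := L (P (n + 1) * P (n + 1)) / L (P n * P n) with hb
  rw [← sub_eq_zero]
  refine eq_zero_of_forall_apply_mul_eq_zero hmonic hdeg horth hpos (n := n + 2) ?_ ?_
  · rw [degree_lt_iff_coeff_zero]
    intro k hk
    obtain ⟨k, rfl⟩ : ∃ j, k = j + 1 := ⟨k - 1, by omega⟩
    have h3 : (P n).coeff (k + 1) = 0 := coeff_eq_zero_of_natDegree_lt (by rw [hdeg]; omega)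
    rw [coeff_sub, coeff_add, coeff_C_mul, coeff_X_mul, h3]
    rcases hk.eq_or_lt with hk | hk
    · obtain rfl : k = n + 1 := by omega
      simp [hc]
    · have h1 : (P (n + 1)).coeff k = 0 := coeff_eq_zero_of_natDegree_lt (by rw [hdeg]; omega)
      have h2 : (P (n + 2)).coeff (k + 1) = 0 :=
        coeff_eq_zero_of_natDegree_lt (by rw [hdeg]; omega)
      simp [h1, h2]
  · intro k hk
    have e : (X * P (n + 1) - (P (n + 2) + C b * P n)) * P k =
        (X * P k) * P (n + 1) - (P (n + 2) * P k + b • (P n * P k)) := by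
      rw [smul_eq_C_mul]; ring
    have hX : (X * P k).natDegree = k + 1 := by
      rw [natDegree_X_mul (hmonic k).ne_zero, hdeg]
    rw [e, map_sub, map_add, map_smul, horth (n + 2) k hk.ne', smul_eq_mul]
    rcases Nat.lt_trichotomy k n with h | h | h
    · rw [horth n k h.ne',
        apply_mul_eq_zero_of_natDegree_lt hmonic hdeg horth (by omega)]
      simp
    · subst h
      rw [apply_mul_monic_orthogonal hmonic hdeg horth hX.le, coeff_X_mul, hc, hb]
      field_simp [(hpos k).ne']
      simp
    · obtain rfl : k = n + 1 := by omega
      have h0 : L (X * P (n + 1) * P (n + 1)) = 0 := by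
        have h1 := heven (X * P (n + 1) * P (n + 1))
        have h2 : (X * P (n + 1) * P (n + 1)).comp (-X) = -(X * P (n + 1) * P (n + 1)) := by
          rw [mul_comp, mul_comp, comp_neg_X_monic_orthogonal hmonic hdeg horth hpos heven]
          have : (C ((-1 : ℝ) ^ (n + 1))) * C ((-1 : ℝ) ^ (n + 1)) = 1 := by
            rw [← C_mul, ← mul_pow]; simp
          rw [X_comp]
          linear_combination (-X * P (n + 1) * P (n + 1)) * this
        rw [h2, map_neg] at h1
        linarith
      rw [h0, horth n (n + 1) (by omega)]
      simp

/-- If `N` represents `Q ↦ L (Q / X ^ 2)`, then `N (X P_{n+1} P_n)` is `L (P_n ^ 2)` for even `n`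
and `0` for odd `n`. -/
theorem apply_X_mul_mul_monic_orthogonal (hmonic : ∀ n, (P n).Monic)
    (hdeg : ∀ n, (P n).natDegree = n) (horth : ∀ m n, m ≠ n → L (P m * P n) = 0)
    (hpos : ∀ n, 0 < L (P n * P n)) (heven : ∀ Q, L (Q.comp (-X)) = L Q)
    {N : ℝ[X] →ₗ[ℝ] ℝ} (hN : ∀ Q, N (X ^ 2 * Q) = L Q) (n : ℕ) :
    2 * N (X * P (n + 1) * P n) = (1 - (-1) ^ (n + 1)) * L (P n * P n) := by
  have hc : ∀ n, (P n).coeff n = 1 := fun n => by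
    have := hmonic n
    rwa [Monic, leadingCoeff, hdeg] at this
  have hX : ∀ n, Odd n → P n = X * divX (P n) := fun n hn => by
    conv_lhs => rw [← X_mul_divX_add (P n)]
    rw [coeff_eq_zero_of_odd_add hmonic hdeg horth hpos heven (n := n) (k := 0) (by simpa using hn)]
    simp
  rcases Nat.even_or_odd n with hn | hn
  · have e : X * P (n + 1) * P n = X ^ 2 * (divX (P (n + 1)) * P n) := by
      conv_lhs => rw [hX (n + 1) hn.add_one]
      ring
    rw [e, hN, apply_mul_monic_orthogonal hmonic hdeg horth
      (by rw [natDegree_divX_eq_natDegree_tsub_one, hdeg]; omega), coeff_divX, hc,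
      hn.add_one.neg_one_pow]
    ring
  · have e : X * P (n + 1) * P n = X ^ 2 * (divX (P n) * P (n + 1)) := by
      conv_lhs => rw [hX n hn]
      ring
    rw [e, hN, apply_mul_eq_zero_of_natDegree_lt hmonic hdeg horth
      (by rw [natDegree_divX_eq_natDegree_tsub_one, hdeg]; omega), hn.add_one.neg_one_pow]
    ring

end OrthogonalPolynomials

section Weight

theorem measurable_w (t : ℝ) : Measurable (w t) := by
  unfold w
  exact Measurable.ite (measurableSet_singleton 0) measurable_const (by fun_prop)

theorem w_nonneg (t x : ℝ) : 0 ≤ w t x := by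
  unfold w
  split_ifs <;> positivity

theorem w_neg (t x : ℝ) : w t (-x) = w t x := by
  simp [w]

theorem w_anti {s t : ℝ} (hst : s ≤ t) (x : ℝ) : w t x ≤ w s x := by
  unfold w
  split_ifs
  · rfl
  · gcongr

theorem w_le_exp {t : ℝ} (ht : 0 < t) (x : ℝ) : w t x ≤ Real.exp (-x ^ 2) := by
  unfold w
  split_ifs
  · positivity
  · apply Real.exp_le_exp.2
    have : 0 ≤ t / x ^ 2 := by positivity
    linarith

theorem w_div_sq_le {t : ℝ} (ht : 0 < t) (x : ℝ) : w t x / x ^ 2 ≤ Real.exp (-x ^ 2) / t := by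
  unfold w
  split_ifs with hx
  · simp only [zero_div]; positivity
  · have hx2 : 0 < x ^ 2 := by positivity
    have h1 : t / x ^ 2 ≤ Real.exp (t / x ^ 2) := by
      linarith [Real.add_one_le_exp (t / x ^ 2)]
    rw [sub_eq_add_neg, Real.exp_add, Real.exp_neg (t / x ^ 2), div_le_div_iff₀ hx2 ht]
    rw [mul_assoc]
    gcongr
    rw [inv_mul_le_iff₀ (Real.exp_pos _)]
    rwa [div_le_iff₀ hx2] at h1

theorem integrable_eval_mul_exp_neg_sq (Q : ℝ[X]) :
    Integrable (fun x : ℝ => Q.eval x * Real.exp (-x ^ 2)) := by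
  induction Q using Polynomial.induction_on' with
  | add p q hp hq => simpa only [eval_add, add_mul] using hp.fun_add hq
  | monomial n a =>
    have h := integrable_rpow_mul_exp_neg_mul_sq (b := 1) one_pos (s := n)
      (by have : (0 : ℝ) ≤ n := n.cast_nonneg
          linarith)
    simpa [mul_assoc] using h.const_mul a

theorem integrable_eval_mul_w (Q : ℝ[X]) {t : ℝ} (ht : 0 < t) :
    Integrable (fun x : ℝ => Q.eval x * w t x) := by
  refine (integrable_eval_mul_exp_neg_sq Q).mono
    (Q.continuous.measurable.mul (measurable_w t)).aestronglyMeasurable (.of_forall fun x => ?_)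
  rw [norm_mul, norm_mul, Real.norm_of_nonneg (w_nonneg t x),
    Real.norm_of_nonneg (Real.exp_pos _).le]
  gcongr
  exact w_le_exp ht x

theorem norm_eval_div_sq_mul_w_le (Q : ℝ[X]) {s t : ℝ} (hs : 0 < s) (hst : s ≤ t) (x : ℝ) :
    ‖Q.eval x / x ^ 2 * w t x‖ ≤ s⁻¹ * ‖Q.eval x * Real.exp (-x ^ 2)‖ := by
  have e : Q.eval x / x ^ 2 * w t x = Q.eval x * (w t x / x ^ 2) := by ring
  have h0 : 0 ≤ w t x / x ^ 2 := div_nonneg (w_nonneg t x) (sq_nonneg x)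
  rw [e, norm_mul, norm_mul, Real.norm_of_nonneg h0, Real.norm_of_nonneg (Real.exp_pos _).le]
  calc ‖Q.eval x‖ * (w t x / x ^ 2) ≤ ‖Q.eval x‖ * (Real.exp (-x ^ 2) / s) :=
        mul_le_mul_of_nonneg_left ((div_le_div_of_nonneg_right (w_anti hst x) (sq_nonneg x)).trans
          (w_div_sq_le hs x)) (norm_nonneg _)
    _ = _ := by ring

theorem integrable_eval_div_sq_mul_w (Q : ℝ[X]) {t : ℝ} (ht : 0 < t) :
    Integrable (fun x : ℝ => Q.eval x / x ^ 2 * w t x) := by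
  refine ((integrable_eval_mul_exp_neg_sq Q).norm.const_mul t⁻¹).mono'
    ((Q.continuous.measurable.div (by fun_prop)).mul (measurable_w t)).aestronglyMeasurable
    (.of_forall fun x => norm_eval_div_sq_mul_w_le Q ht le_rfl x)

theorem hasDerivAt_w (t x : ℝ) : HasDerivAt (fun s => w s x) (-(w t x / x ^ 2)) t := by
  unfold w
  split_ifs with hx
  · simpa using hasDerivAt_const t (0 : ℝ)
  · have h := (((hasDerivAt_id t).div_const (x ^ 2)).const_sub (-x ^ 2)).exp
    refine h.congr_deriv ?_
    simp only [id]
    ring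

theorem hasDerivAt_integral_eval_mul_w (Q : ℝ[X]) {t : ℝ} (ht : 0 < t) :
    HasDerivAt (fun s => ∫ x : ℝ, Q.eval x * w s x)
      (-∫ x : ℝ, Q.eval x / x ^ 2 * w t x) t := by
  rw [← integral_neg]
  refine (hasDerivAt_integral_of_dominated_loc_of_deriv_le (𝕜 := ℝ) (μ := volume)
    (F := fun s x => Q.eval x * w s x) (F' := fun s x => -(Q.eval x / x ^ 2 * w s x))
    (s := Set.Ioi (t / 2)) (x₀ := t)
    (bound := fun x => (t / 2)⁻¹ * ‖Q.eval x * Real.exp (-x ^ 2)‖)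
    (Ioi_mem_nhds (by linarith)) (.of_forall fun s => ?_) (integrable_eval_mul_w Q ht)
    (integrable_eval_div_sq_mul_w Q ht).neg.aestronglyMeasurable
    (.of_forall fun x s hs => ?_)
    ((integrable_eval_mul_exp_neg_sq Q).norm.const_mul _)
    (.of_forall fun x s _ => ?_)).2
  · exact (Q.continuous.measurable.mul (measurable_w s)).aestronglyMeasurable
  · rw [norm_neg]
    exact norm_eval_div_sq_mul_w_le Q (by linarith) (le_of_lt hs) x
  · refine ((hasDerivAt_w s x).const_mul (Q.eval x)).congr_deriv ?_
    ring

/-- The functional `Q ↦ ∫ Q(x) w(x,t) dx`. -/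
noncomputable def weightFunctional (t : ℝ) (ht : 0 < t) : ℝ[X] →ₗ[ℝ] ℝ where
  toFun Q := ∫ x : ℝ, Q.eval x * w t x
  map_add' p q := by
    simp only [eval_add, add_mul]
    exact integral_add (integrable_eval_mul_w p ht) (integrable_eval_mul_w q ht)
  map_smul' c p := by
    simp only [eval_smul, smul_eq_mul, mul_assoc, RingHom.id_apply, integral_const_mul]

/-- The functional `Q ↦ ∫ x⁻² Q(x) w(x,t) dx`. -/
noncomputable def invSqWeightFunctional (t : ℝ) (ht : 0 < t) : ℝ[X] →ₗ[ℝ] ℝ where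
  toFun Q := ∫ x : ℝ, Q.eval x / x ^ 2 * w t x
  map_add' p q := by
    simp only [eval_add, add_div, add_mul]
    exact integral_add (integrable_eval_div_sq_mul_w p ht) (integrable_eval_div_sq_mul_w q ht)
  map_smul' c p := by
    simp only [eval_smul, smul_eq_mul, mul_assoc, mul_div_assoc, RingHom.id_apply,
      integral_const_mul]

theorem weightFunctional_comp_neg_X {t : ℝ} (ht : 0 < t) (Q : ℝ[X]) :
    weightFunctional t ht (Q.comp (-X)) = weightFunctional t ht Q := by
  change ∫ x : ℝ, (Q.comp (-X)).eval x * w t x = ∫ x : ℝ, Q.eval x * w t x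
  rw [← integral_neg_eq_self (fun x : ℝ => Q.eval x * w t x)]
  simp [w_neg]

theorem invSqWeightFunctional_X_sq_mul {t : ℝ} (ht : 0 < t) (Q : ℝ[X]) :
    invSqWeightFunctional t ht (X ^ 2 * Q) = weightFunctional t ht Q := by
  refine integral_congr_ae (.of_forall fun x => ?_)
  by_cases hx : x = 0
  · simp [w, hx]
  · simp only [eval_mul, eval_pow, eval_X]
    field_simp

end Weight

theorem statement13
    (P : ℕ → ℝ → Polynomial ℝ)
    (hmonic : ∀ n : ℕ, ∀ t : ℝ, 0 < t → (P n t).Monic)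
    (hdeg : ∀ n : ℕ, ∀ t : ℝ, 0 < t → (P n t).natDegree = n)
    (horth : ∀ m n : ℕ, m ≠ n → ∀ t : ℝ, 0 < t →
      ∫ x : ℝ, (P m t).eval x * (P n t).eval x * w t x = 0)
    (hcoeff : ∀ n k : ℕ, ∀ t : ℝ, 0 < t →
      DifferentiableAt ℝ (fun s => (P n s).coeff k) t)
    (h : ℕ → ℝ → ℝ)
    (hh : ∀ n : ℕ, ∀ t : ℝ, 0 < t → h n t = ∫ x : ℝ, ((P n t).eval x) ^ 2 * w t x)
    (hhpos : ∀ n : ℕ, ∀ t : ℝ, 0 < t → 0 < h n t)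
    (R : ℕ → ℝ → ℝ)
    (hR : ∀ n : ℕ, ∀ t : ℝ, 0 < t →
      R n t = 2 * t / h n t * ∫ y : ℝ, ((P n t).eval y) ^ 2 / y ^ 2 * w t y)
    (β : ℕ → ℝ → ℝ)
    (hβ : ∀ n : ℕ, 1 ≤ n → ∀ t : ℝ, 0 < t → β n t = h n t / h (n - 1) t)
    (p : ℕ → ℝ → ℝ)
    (hp : ∀ n : ℕ, 2 ≤ n → ∀ t : ℝ, 0 < t → p n t = (P n t).coeff (n - 2))
    (n : ℕ) (hn : 2 ≤ n) (t₀ : ℝ) (ht₀ : 0 < t₀) :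
    ∃ d : ℝ, HasDerivAt (p n) d t₀ ∧
      2 * t₀ * d = (1 - (-1 : ℝ) ^ n) * t₀ - β n t₀ * R n t₀ := by
  obtain ⟨m, rfl⟩ : ∃ m, n = m + 2 := ⟨n - 2, by omega⟩
  have hL : ∀ t (ht : 0 < t) Q, weightFunctional t ht Q = ∫ x : ℝ, Q.eval x * w t x :=
    fun _ _ _ => rfl
  have hN : ∀ t (ht : 0 < t) Q,
      invSqWeightFunctional t ht Q = ∫ x : ℝ, Q.eval x / x ^ 2 * w t x := fun _ _ _ => rfl
  have mon : ∀ t, 0 < t → ∀ n, (P n t).Monic := fun t ht n => hmonic n t ht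
  have deg : ∀ t, 0 < t → ∀ n, (P n t).natDegree = n := fun t ht n => hdeg n t ht
  have orth : ∀ t (ht : 0 < t), ∀ m n, m ≠ n → weightFunctional t ht (P m t * P n t) = 0 :=
    fun t ht m n hmn => by
      simpa only [hL, eval_mul] using horth m n hmn t ht
  have norm : ∀ t (ht : 0 < t), ∀ n, weightFunctional t ht (P n t * P n t) = h n t :=
    fun t ht n => by
      simp only [hL, eval_mul, hh n t ht, sq]
  have pos : ∀ t (ht : 0 < t), ∀ n, 0 < weightFunctional t ht (P n t * P n t) :=
    fun t ht n => by
      rw [norm]; exact hhpos n t ht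
  have even := fun t (ht : 0 < t) => weightFunctional_comp_neg_X ht
  have invSq := fun t (ht : 0 < t) => invSqWeightFunctional_X_sq_mul ht
  have lead : ∀ t, 0 < t → ∀ n, (P n t).coeff n = 1 := fun t ht n => by
    have := mon t ht n
    rwa [Monic, leadingCoeff, deg t ht] at this
  set d := deriv (fun s => (P (m + 2) s).coeff m) t₀ with hd
  have hdp : HasDerivAt (fun s => (P (m + 2) s).coeff m) d t₀ :=
    (hcoeff (m + 2) m t₀ ht₀).hasDerivAt
  -- differentiating the orthogonality relation against the fixed polynomial `P m t₀`
  have key : d * h m t₀ = invSqWeightFunctional t₀ ht₀ (P (m + 2) t₀ * P m t₀) := by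
    set Q := P m t₀ with hQ
    have hsum : HasDerivAt
        (fun s => ∑ k ∈ Finset.range (m + 3),
          (P (m + 2) s).coeff k * ∫ x : ℝ, (X ^ k * Q).eval x * w s x)
        (∑ k ∈ Finset.range (m + 3),
          (deriv (fun s => (P (m + 2) s).coeff k) t₀ * ∫ x : ℝ, (X ^ k * Q).eval x * w t₀ x) +
        ∑ k ∈ Finset.range (m + 3),
          (P (m + 2) t₀).coeff k * -∫ x : ℝ, (X ^ k * Q).eval x / x ^ 2 * w t₀ x) t₀ := by
      rw [← Finset.sum_add_distrib]
      exact HasDerivAt.fun_sum fun k _ => (hcoeff (m + 2) k t₀ ht₀).hasDerivAt.mul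
        (hasDerivAt_integral_eval_mul_w (X ^ k * Q) ht₀)
    have expand : ∀ t, 0 < t → P (m + 2) t * Q =
        ∑ k ∈ Finset.range (m + 3), (P (m + 2) t).coeff k • (X ^ k * Q) := fun t ht => by
      conv_lhs => rw [(P (m + 2) t).as_sum_range_C_mul_X_pow, deg t ht, Finset.sum_mul]
      simp only [smul_eq_C_mul, mul_assoc]
    have hzero : (fun s => ∑ k ∈ Finset.range (m + 3),
        (P (m + 2) s).coeff k * ∫ x : ℝ, (X ^ k * Q).eval x * w s x) =ᶠ[nhds t₀] fun _ => 0 := by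
      filter_upwards [Ioi_mem_nhds ht₀] with s (hs : 0 < s)
      have h0 : weightFunctional s hs (P (m + 2) s * Q) = 0 := by
        rw [mul_comm]
        exact apply_mul_eq_zero_of_natDegree_lt (mon s hs) (deg s hs) (orth s hs)
          (by rw [hQ, deg t₀ ht₀]; omega)
      rw [expand s hs, map_sum] at h0
      rw [← h0]
      exact Finset.sum_congr rfl fun k _ => by rw [map_smul, smul_eq_mul, hL]
    have huniq := hsum.unique ((hasDerivAt_const t₀ (0 : ℝ)).congr_of_eventuallyEq hzero)
    have hfirst : ∑ k ∈ Finset.range (m + 3), (deriv (fun s => (P (m + 2) s).coeff k) t₀ *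
        ∫ x : ℝ, (X ^ k * Q).eval x * w t₀ x) = d * h m t₀ := by
      rw [Finset.sum_eq_single_of_mem m (by simp)]
      · rw [← hL t₀ ht₀, apply_mul_monic_orthogonal (mon t₀ ht₀) (deg t₀ ht₀) (orth t₀ ht₀)
          (by simp), norm]
        simp [hd]
      · intro k hk hkm
        rcases lt_or_gt_of_ne hkm with hlt | hgt
        · rw [← hL t₀ ht₀, apply_mul_eq_zero_of_natDegree_lt (mon t₀ ht₀) (deg t₀ ht₀)
            (orth t₀ ht₀) (by simpa using hlt), mul_zero]
        · have hconst : ∃ c : ℝ, ∀ s, 0 < s → (P (m + 2) s).coeff k = c := by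
            have hk' : k = m + 1 ∨ k = m + 2 := by
              have := Finset.mem_range.1 hk
              omega
            rcases hk' with rfl | rfl
            · exact ⟨0, fun s hs => coeff_eq_zero_of_odd_add (mon s hs) (deg s hs) (orth s hs)
                (pos s hs) (even s hs) (by grind)⟩
            · exact ⟨1, fun s hs => lead s hs _⟩
          obtain ⟨c, hc⟩ := hconst
          have : (fun s => (P (m + 2) s).coeff k) =ᶠ[nhds t₀] fun _ => c := by
            filter_upwards [Ioi_mem_nhds ht₀] with s hs using hc s hs
          rw [this.deriv_eq, deriv_const, zero_mul]
    have hsecond : ∑ k ∈ Finset.range (m + 3),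
        (P (m + 2) t₀).coeff k * -∫ x : ℝ, (X ^ k * Q).eval x / x ^ 2 * w t₀ x =
        -invSqWeightFunctional t₀ ht₀ (P (m + 2) t₀ * Q) := by
      rw [expand t₀ ht₀, map_sum, ← Finset.sum_neg_distrib]
      exact Finset.sum_congr rfl fun k _ => by rw [map_smul, smul_eq_mul, hN, mul_neg]
    rw [hfirst, hsecond] at huniq
    linarith
  refine ⟨d, hdp.congr_of_eventuallyEq ?_, ?_⟩
  · filter_upwards [Ioi_mem_nhds ht₀] with s hs
    rw [hp (m + 2) hn s hs, Nat.add_sub_cancel]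
  · have hm := hhpos m t₀ ht₀
    have hm1 := hhpos (m + 1) t₀ ht₀
    have hm2 := hhpos (m + 2) t₀ ht₀
    have recurrence := X_mul_monic_orthogonal (mon t₀ ht₀) (deg t₀ ht₀) (orth t₀ ht₀) (pos t₀ ht₀)
      (even t₀ ht₀) m
    have cross := apply_X_mul_mul_monic_orthogonal (mon t₀ ht₀) (deg t₀ ht₀) (orth t₀ ht₀)
      (pos t₀ ht₀) (even t₀ ht₀) (invSq t₀ ht₀) (m + 1)
    rw [norm, norm] at recurrence
    rw [norm] at cross
    have decomp : X * P (m + 1 + 1) t₀ * P (m + 1) t₀ = P (m + 2) t₀ * P (m + 2) t₀ +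
        (h (m + 1) t₀ / h m t₀) • (P (m + 2) t₀ * P m t₀) := by
      rw [smul_eq_C_mul]
      linear_combination P (m + 2) t₀ * recurrence
    rw [decomp, map_add, map_smul, ← key, smul_eq_mul] at cross
    have hRN : R (m + 2) t₀ = 2 * t₀ / h (m + 2) t₀ *
        invSqWeightFunctional t₀ ht₀ (P (m + 2) t₀ * P (m + 2) t₀) := by
      rw [hR _ _ ht₀, hN]
      simp only [eval_mul, sq]
    rw [hRN, hβ (m + 2) (by omega) t₀ ht₀, show m + 2 - 1 = m + 1 by omega]
    set A := invSqWeightFunctional t₀ ht₀ (P (m + 2) t₀ * P (m + 2) t₀)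
    rw [show m + 1 + 1 = m + 2 by omega] at cross
    field_simp at cross ⊢
    linear_combination cross
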